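/- Let Γ = {x_1, …, x_N} be a finite set of points in ℝ^d with Voronoi cell V_j, let U ⊆ ℝ^d be a closed ball, let a ∈ ℝ^d, let v ∈ ℝ^d be a unit vector, and let L > 0. For n ≥ 2 set δr_n = L/(n−1) and r_i = a + (i·δr_n)·v for i = 0, …, n−1. Then δr_n · #{i : r_i ∈ V_j ∩ U} converges, as n → ∞, to L_j(a, v), the one-dimensional Lebesgue measure of {t ∈ [0, L] : a + t·v ∈ V_j ∩ U}. -/

import Mathlib

open MeasureTheory Filter

/-- The Voronoi cell of the point `x j` among the finite point set `{x 1, …, x N}` in `ℝ^d`. -/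
def voronoiCell {d N : ℕ} (x : Fin N → EuclideanSpace ℝ (Fin d)) (j : Fin N) :
    Set (EuclideanSpace ℝ (Fin d)) :=
  {p | ∀ i, ‖p - x j‖ ≤ ‖p - x i‖}

/-- `L_j(a, v)`: the one-dimensional Lebesgue measure of the set of parameters
`t ∈ [0, L]` such that `a + t • v` lies in the given set `A` (here `A = V_j ∩ U`). -/
noncomputable def rayLength {d : ℕ} (A : Set (EuclideanSpace ℝ (Fin d))) (L : ℝ)
    (a v : EuclideanSpace ℝ (Fin d)) : ℝ :=
  (volume {t ∈ Set.Icc (0 : ℝ) L | a + t • v ∈ A}).toReal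

/-- The weighted count of multiples of `δ` in `[p, q]` differs from `q - p` by at most `δ`. -/
theorem abs_mul_ncard_multiples_Icc_sub_le {δ p q : ℝ} (hδ : 0 < δ) (hp : 0 ≤ p) (hpq : p ≤ q) :
    |δ * ({i : ℕ | (i : ℝ) * δ ∈ Set.Icc p q}.ncard : ℝ) - (q - p)| ≤ δ := by
  have hset : {i : ℕ | (i : ℝ) * δ ∈ Set.Icc p q} = (Finset.Icc ⌈p / δ⌉₊ ⌊q / δ⌋₊ : Set ℕ) := by
    ext i
    simp only [Set.mem_ofPred_eq, Set.mem_Icc, Finset.coe_Icc, Nat.ceil_le,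
      Nat.le_floor_iff (div_nonneg (hp.trans hpq) hδ.le), div_le_iff₀ hδ, le_div_iff₀ hδ]
  have hle : ⌈p / δ⌉₊ ≤ ⌊q / δ⌋₊ + 1 :=
    (Nat.ceil_le_floor_add_one _).trans (by gcongr)
  rw [hset, Set.ncard_coe_finset, Nat.card_Icc, Nat.cast_sub hle]
  push_cast
  have hp₁ := Nat.le_ceil (p / δ)
  have hp₂ := Nat.ceil_lt_add_one (div_nonneg hp hδ.le)
  have hq₁ := Nat.floor_le (div_nonneg (hp.trans hpq) hδ.le)
  have hq₂ := Nat.lt_floor_add_one (q / δ)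
  have hpδ : δ * (p / δ) = p := by field_simp
  have hqδ : δ * (q / δ) = q := by field_simp
  rw [abs_le]
  constructor <;> nlinarith

/-- The set of points at least as close to `y` as to `z` is convex. -/
theorem convex_setOf_norm_sub_le_norm_sub {E : Type*} [NormedAddCommGroup E]
    [InnerProductSpace ℝ E] (y z : E) : Convex ℝ {p : E | ‖p - y‖ ≤ ‖p - z‖} := by
  have hset : {p : E | ‖p - y‖ ≤ ‖p - z‖} =
      {p : E | innerSL ℝ (z - y) p ≤ (‖z‖ ^ 2 - ‖y‖ ^ 2) / 2} := by
    ext p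
    have hy := norm_sub_sq_real p y
    have hz := norm_sub_sq_real p z
    rw [Set.mem_ofPred_eq, Set.mem_ofPred_eq, ← sq_le_sq₀ (norm_nonneg _) (norm_nonneg _),
      innerSL_apply_apply, inner_sub_left, real_inner_comm p z, real_inner_comm p y]
    constructor <;> intro h <;> linarith
  rw [hset]
  exact convex_halfSpace_le (innerSL ℝ (z - y)).toLinearMap.isLinear _

theorem convex_voronoiCell {d N : ℕ} (x : Fin N → EuclideanSpace ℝ (Fin d)) (j : Fin N) :
    Convex ℝ (voronoiCell x j) := by
  rw [voronoiCell, Set.ofPred_forall]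
  exact convex_iInter fun i => convex_setOf_norm_sub_le_norm_sub (x j) (x i)

theorem isClosed_voronoiCell {d N : ℕ} (x : Fin N → EuclideanSpace ℝ (Fin d)) (j : Fin N) :
    IsClosed (voronoiCell x j) := by
  rw [voronoiCell, Set.ofPred_forall]
  exact isClosed_iInter fun i => isClosed_le (by fun_prop) (by fun_prop)

/-- Equispaced sampling of a segment computes the length of its part in a closed convex set. -/
theorem tendsto_sample_count_of_convex_of_isClosed {d : ℕ} {A : Set (EuclideanSpace ℝ (Fin d))}
    (hA : Convex ℝ A) (hA' : IsClosed A) (a v : EuclideanSpace ℝ (Fin d)) {L : ℝ} (hL : 0 < L) :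
    Tendsto
      (fun n : ℕ => (L / ((n : ℝ) - 1)) *
        ({i : ℕ | i < n ∧ a + ((i : ℝ) * (L / ((n : ℝ) - 1))) • v ∈ A}.ncard : ℝ))
      atTop (nhds (rayLength A L a v)) := by
  set T : Set ℝ := {t ∈ Set.Icc (0 : ℝ) L | a + t • v ∈ A} with hT
  have hcompact : IsCompact T :=
    isCompact_Icc.inter_right (hA'.preimage (f := fun t : ℝ => a + t • v) (by fun_prop))
  have hconvex : Convex ℝ T := by
    refine (convex_Icc 0 L).inter (t := {t : ℝ | a + t • v ∈ A}) ?_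
    have hpre := hA.affine_preimage (AffineMap.lineMap a (a + v) : ℝ →ᵃ[ℝ] _)
    have hset : {t : ℝ | a + t • v ∈ A} = (AffineMap.lineMap a (a + v) : ℝ →ᵃ[ℝ] _) ⁻¹' A := by
      ext t
      simp [AffineMap.lineMap_apply, add_comm]
    rw [hset]
    exact hpre
  have hδpos : ∀ n : ℕ, 2 ≤ n → 0 < L / ((n : ℝ) - 1) := fun n hn => by
    have : (2 : ℝ) ≤ n := by exact_mod_cast hn
    exact div_pos hL (by linarith)
  have hsample : ∀ n : ℕ, 2 ≤ n →
      {i : ℕ | i < n ∧ a + ((i : ℝ) * (L / ((n : ℝ) - 1))) • v ∈ A} =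
        {i : ℕ | (i : ℝ) * (L / ((n : ℝ) - 1)) ∈ T} := fun n hn => by
    have hn' : (0 : ℝ) < n - 1 := by
      have : (2 : ℝ) ≤ n := by exact_mod_cast hn
      linarith
    ext i
    have hiff : (i : ℝ) * (L / ((n : ℝ) - 1)) ≤ L ↔ i < n := by
      rw [← mul_div_assoc, div_le_iff₀ hn', mul_comm, mul_le_mul_iff_right₀ hL, le_sub_iff_add_le]
      exact_mod_cast Nat.succ_le_iff
    have hnonneg : 0 ≤ (i : ℝ) * (L / ((n : ℝ) - 1)) :=
      mul_nonneg i.cast_nonneg (hδpos n hn).le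
    simp only [hT, Set.mem_ofPred_eq, Set.mem_Icc, hiff, hnonneg, true_and]
  rw [rayLength, ← hT]
  rcases T.eq_empty_or_nonempty with hempty | hne
  · rw [hempty]
    refine tendsto_nhds_of_eventually_eq ?_
    filter_upwards [eventually_ge_atTop 2] with n hn
    simp [hsample n hn, hempty]
  · have hIcc : T = Set.Icc (sInf T) (sSup T) :=
      eq_Icc_of_connected_compact ⟨hne, hconvex.isPreconnected⟩ hcompact
    have hle : sInf T ≤ sSup T := Real.sInf_le_sSup T hcompact.bddBelow hcompact.bddAbove
    have hnonneg : 0 ≤ sInf T := (hcompact.sInf_mem hne).1.1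
    have hvol : (volume T).toReal = sSup T - sInf T := by
      rw [hIcc, Real.volume_Icc, ENNReal.toReal_ofReal (sub_nonneg.2 (hIcc ▸ hle)), ← hIcc]
    have hδ : Tendsto (fun n : ℕ => L / ((n : ℝ) - 1)) atTop (nhds 0) :=
      tendsto_const_nhds.div_atTop
        (tendsto_atTop_add_const_right _ _ tendsto_natCast_atTop_atTop)
    rw [hvol, tendsto_iff_dist_tendsto_zero]
    refine squeeze_zero' (Eventually.of_forall fun _ => dist_nonneg) ?_ hδ
    filter_upwards [eventually_ge_atTop 2] with n hn
    rw [Real.dist_eq, hsample n hn]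
    have h := abs_mul_ncard_multiples_Icc_sub_le (hδpos n hn) hnonneg hle
    rwa [← hIcc] at h

/-- along a ray with base `a`, unit direction `v`, length `L`, and `n`
equispaced sample points `r_i = a + (i·δr_n) • v` with `δr_n = L/(n-1)`, the weighted
count `δr_n · #{i : r_i ∈ V_j ∩ U}` converges as `n → ∞` to `L_j(a, v)`, the
one-dimensional Lebesgue measure of `{t ∈ [0, L] : a + t • v ∈ V_j ∩ U}`. -/
theorem ray_sample_count_tendsto_rayLength (d N : ℕ)
    (x : Fin N → EuclideanSpace ℝ (Fin d)) (j : Fin N)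
    (U : Set (EuclideanSpace ℝ (Fin d)))
    (hU : ∃ c R, 0 ≤ R ∧ U = Metric.closedBall c R)
    (a v : EuclideanSpace ℝ (Fin d)) (hv : ‖v‖ = 1) (L : ℝ) (hL : 0 < L) :
    Tendsto
      (fun n : ℕ =>
        (L / ((n : ℝ) - 1)) *
          ({i : ℕ | i < n ∧
            a + ((i : ℝ) * (L / ((n : ℝ) - 1))) • v ∈ voronoiCell x j ∩ U}.ncard : ℝ))
      atTop
      (nhds (rayLength (voronoiCell x j ∩ U) L a v)) := by
  obtain ⟨c, R, -, rfl⟩ := hU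
  exact tendsto_sample_count_of_convex_of_isClosed
    ((convex_voronoiCell x j).inter (convex_closedBall c R))
    ((isClosed_voronoiCell x j).inter Metric.isClosed_closedBall) a v hL
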